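/- Let H be Hall's universal group. Then there is an injective group homomorphism from the full symmetric group Sym(ℕ) (the group of all permutations of a countably infinite set) into Aut(H). -/

import Mathlib

/-- A group is locally finite if its finitely generated subgroups are finite. -/
def LocallyFiniteGroup (G : Type*) [Group G] : Prop :=
  ∀ s : Set G, s.Finite → (Subgroup.closure s : Set G).Finite

/-- Any two embeddings of a finite group into `G` become conjugate under the homomorphism `j`. -/
def ConjugatesFiniteEmbeddings {G E : Type*} [Group G] [Group E] (j : G →* E) : Prop :=
  ∀ (K : Type) [Group K] [Finite K] (f f' : K →* G), Function.Injective f →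
    Function.Injective f' → ∃ t : E, ∀ k, j (f' k) = t * j (f k) * t⁻¹

namespace LocallyFiniteGroup

theorem of_injective {G E : Type*} [Group G] [Group E] (hE : LocallyFiniteGroup E)
    (f : G →* E) (hf : Function.Injective f) : LocallyFiniteGroup G := by
  intro s hs
  refine Set.Finite.of_finite_image ?_ hf.injOn (f := f)
  rw [← Subgroup.coe_map, MonoidHom.map_closure]
  exact hE _ (hs.image f)

theorem finite_closure_of_subset {G : Type*} [Group G] {E : Subgroup G}
    (hE : LocallyFiniteGroup E) {s : Set G} (hs : s.Finite) (hsE : s ⊆ E) :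
    (Subgroup.closure s : Set G).Finite := by
  have h := hE (E.subtype ⁻¹' s) (hs.preimage E.subtype_injective.injOn)
  have h2 := h.image E.subtype
  rw [← Subgroup.coe_map, MonoidHom.map_closure, Set.image_preimage_eq_of_subset] at h2
  · exact h2
  · simpa using hsE

theorem of_finite_closure_of_subset {G : Type*} [Group G] {E : Subgroup G}
    (h : ∀ s : Set G, s.Finite → s ⊆ E → (Subgroup.closure s : Set G).Finite) :
    LocallyFiniteGroup E := by
  intro s hs
  refine Set.Finite.of_finite_image ?_ E.subtype_injective.injOn (f := E.subtype)
  rw [← Subgroup.coe_map, MonoidHom.map_closure]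
  refine h _ (hs.image _) ?_
  rintro _ ⟨x, -, rfl⟩
  exact x.2

theorem finite_closure_biUnion {G : Type*} [Group G] (hG : LocallyFiniteGroup G) {ι : Type*}
    {s : Set ι} (hs : s.Finite) (F : ι → Subgroup G) (hF : ∀ i ∈ s, (F i : Set G).Finite) :
    (Subgroup.closure (⋃ i ∈ s, (F i : Set G)) : Set G).Finite :=
  hG _ (hs.biUnion hF)

/-- Powers of a finite group are locally finite. -/
theorem pi (I P : Type*) [Group P] [Finite P] : LocallyFiniteGroup (I → P) := by
  intro s hs
  have := hs.to_subtype
  let r : ((s → P) → P) →* (I → P) :=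
    { toFun := fun φ i => φ fun u => u.1 i
      map_one' := rfl
      map_mul' := fun _ _ => rfl }
  have hle : Subgroup.closure s ≤ r.range := by
    rw [Subgroup.closure_le]
    intro u hu
    exact ⟨fun w => w ⟨u, hu⟩, rfl⟩
  exact (Set.finite_range r).subset hle

/-- A group generated by the union of a system of locally finite subgroups, directed along the
finite subgroups of a locally finite group, is locally finite. -/
theorem closure_of_monotone {G U : Type*} [Group G] [Group U] (hG : LocallyFiniteGroup G)
    (D : Subgroup G → Subgroup U) (hD : Monotone D)
    (hDF : ∀ F : Subgroup G, (F : Set G).Finite → LocallyFiniteGroup (D F))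
    (S : Set U) (hS : ∀ u ∈ S, ∃ F : Subgroup G, (F : Set G).Finite ∧ u ∈ D F) :
    LocallyFiniteGroup (Subgroup.closure S) := by
  have key : ∀ u ∈ Subgroup.closure S, ∃ F : Subgroup G, (F : Set G).Finite ∧ u ∈ D F := by
    intro u hu
    induction hu using Subgroup.closure_induction with
    | mem u hu => exact hS u hu
    | one => exact ⟨⊥, by simp, one_mem _⟩
    | mul u v _ _ hu hv =>
      obtain ⟨F, hF, hu⟩ := hu
      obtain ⟨F', hF', hv⟩ := hv
      have h : (F ⊔ F' : Subgroup G) = Subgroup.closure ((F : Set G) ∪ F') := by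
        rw [Subgroup.closure_union, Subgroup.closure_eq, Subgroup.closure_eq]
      refine ⟨F ⊔ F', ?_, mul_mem (hD le_sup_left hu) (hD le_sup_right hv)⟩
      rw [h]
      exact hG _ (hF.union hF')
    | inv u _ hu =>
      obtain ⟨F, hF, hu⟩ := hu
      exact ⟨F, hF, inv_mem hu⟩
  refine of_finite_closure_of_subset fun s hs hsE => ?_
  choose! F hF using key
  refine finite_closure_of_subset
    (hDF _ (hG.finite_closure_biUnion hs F fun u hu => (hF u (hsE hu)).1)) hs fun u hu => ?_
  exact hD (fun x hx => Subgroup.subset_closure (Set.mem_biUnion hu hx)) (hF u (hsE hu)).2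

end LocallyFiniteGroup

theorem Subgroup.countable_closure_of_countable {G : Type*} [Group G] {s : Set G}
    (hs : s.Countable) : Countable (Subgroup.closure s) := by
  have := hs.to_subtype
  have : Function.Surjective (FreeGroup.lift (Subtype.val : s → G)).rangeRestrict :=
    MonoidHom.rangeRestrict_surjective _
  rw [← Subtype.range_coe (s := s), ← FreeGroup.range_lift_eq_closure]
  have : Countable (FreeGroup s) := Quot.mk_surjective.countable
  exact Function.Surjective.countable ‹Function.Surjective _›

/-- The restriction of an action by automorphisms to an invariant subgroup. -/
def MulAut.restrictHom {A U : Type*} [Group A] [Group U] (ψ : A →* MulAut U) (E : Subgroup U)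
    (h : ∀ a, ∀ e ∈ E, ψ a e ∈ E) : A →* MulAut E where
  toFun a :=
    { toFun := fun e => ⟨ψ a e, h a e e.2⟩
      invFun := fun e => ⟨ψ a⁻¹ e, h a⁻¹ e e.2⟩
      left_inv := fun e => by simp
      right_inv := fun e => by simp
      map_mul' := fun e e' => by simp }
  map_one' := by ext; simp
  map_mul' a b := by ext; simp

theorem MulAut.map_mem_closure_of_forall {A U : Type*} [Group A] [Group U] (ψ : A →* MulAut U)
    (S : Set U) (h : ∀ a, ∀ u ∈ S, ψ a u ∈ S) (a : A) (e : U) (he : e ∈ Subgroup.closure S) :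
    ψ a e ∈ Subgroup.closure S := by
  have : Subgroup.closure S ≤ (Subgroup.closure S).comap (ψ a).toMonoidHom := by
    rw [Subgroup.closure_le]
    exact fun u hu => Subgroup.subset_closure (h a u hu)
  exact this he

/-- Two embeddings of a finite group into a finite group are intertwined by a permutation. -/
theorem exists_perm_mul_right_of_finite {F K : Type*} [Group F] [Finite F] [Group K] [Finite K]
    (f f' : K →* F) (hf : Function.Injective f) (hf' : Function.Injective f') :
    ∃ σ : Equiv.Perm F, ∀ x k, σ (x * f k) = σ x * f' k := by
  have hcard : Nat.card (F ⧸ f.range) = Nat.card (F ⧸ f'.range) := by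
    have h1 := f.range.card_eq_card_quotient_mul_card_subgroup
    have h2 := f'.range.card_eq_card_quotient_mul_card_subgroup
    rw [← Nat.card_congr (MonoidHom.ofInjective hf).toEquiv] at h1
    rw [← Nat.card_congr (MonoidHom.ofInjective hf').toEquiv] at h2
    exact Nat.eq_of_mul_eq_mul_right Nat.card_pos (h1.symm.trans h2)
  obtain ⟨q⟩ : Nonempty (F ⧸ f.range ≃ F ⧸ f'.range) := Finite.card_eq.1 hcard
  have hκ : ∀ x : F, ∃ k : K, (x : F ⧸ f.range).out * f k = x := by
    intro x
    have h : (((x : F ⧸ f.range).out : F) : F ⧸ f.range) = x := QuotientGroup.out_eq' _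
    obtain ⟨k, hk⟩ := QuotientGroup.eq.1 h
    exact ⟨k, by rw [hk]; group⟩
  choose κ hκ using hκ
  have hmk : ∀ x k, ((x * f k : F) : F ⧸ f.range) = x := fun x k =>
    QuotientGroup.mk_mul_of_mem _ ⟨k, rfl⟩
  have hκm : ∀ x k, κ (x * f k) = κ x * k := by
    intro x k
    apply hf
    have h := hκ (x * f k)
    rw [hmk] at h
    refine mul_left_cancel (a := (x : F ⧸ f.range).out) ?_
    rw [h, map_mul, ← mul_assoc, hκ x]
  let σ : F → F := fun x => (q x).out * f' (κ x)
  have hσ : Function.Injective σ := by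
    intro x y hxy
    have hq : q x = q y := by
      have h := congrArg (fun z : F => (z : F ⧸ f'.range)) hxy
      simpa [σ, QuotientGroup.mk_mul_of_mem] using h
    have hk : κ x = κ y := hf' (by simpa [σ, hq] using hxy)
    rw [← hκ x, ← hκ y, hk, q.injective hq]
  refine ⟨Equiv.ofBijective σ (Finite.injective_iff_bijective.1 hσ), fun x k => ?_⟩
  simp [σ, hmk, hκm, mul_assoc]

/-- Two embeddings of a finite group with values in a finite subgroup `F` are intertwined by a
permutation preserving the cosets of `F`. -/
theorem exists_perm_mul_right {G K : Type*} [Group G] [Group K] [Finite K]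
    (f f' : K →* G) (hf : Function.Injective f) (hf' : Function.Injective f')
    (F : Subgroup G) (hF : (F : Set G).Finite) (hfF : ∀ k, f k ∈ F) (hfF' : ∀ k, f' k ∈ F) :
    ∃ π : Equiv.Perm G, (∀ x, x⁻¹ * π x ∈ F) ∧ ∀ x k, π (x * f k) = π x * f' k := by
  have : Finite F := hF.to_subtype
  obtain ⟨σ, hσ⟩ := exists_perm_mul_right_of_finite (f.codRestrict F hfF) (f'.codRestrict F hfF')
    (fun _ _ h => hf (congrArg Subtype.val h)) (fun _ _ h => hf' (congrArg Subtype.val h))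
  let c : G → G := fun x => (x : G ⧸ F).out
  have hc : ∀ x, (c x)⁻¹ * x ∈ F := fun x => QuotientGroup.eq.1 (QuotientGroup.out_eq' _)
  have hcm : ∀ x, ∀ y ∈ F, c (x * y) = c x := fun x y hy => by
    simp only [c, QuotientGroup.mk_mul_of_mem x hy]
  have hcc : ∀ x, c (c x) = c x := fun x => by
    have h := hcm (c x) _ (hc x)
    rw [mul_inv_cancel_left] at h
    exact h.symm
  let p : Equiv.Perm F → G → G := fun σ x => c x * σ ⟨(c x)⁻¹ * x, hc x⟩
  have hcp : ∀ σ x, c (p σ x) = c x := fun σ x => by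
    simp only [p]
    rw [hcm _ _ (SetLike.coe_mem _), hcc]
  have hpp : ∀ σ τ : Equiv.Perm F, (∀ x, σ (τ x) = x) → ∀ x, p σ (p τ x) = x := by
    intro σ τ h x
    have h1 : (⟨(c (p τ x))⁻¹ * p τ x, hc _⟩ : F) = τ ⟨(c x)⁻¹ * x, hc x⟩ := by
      ext
      simp only [hcp]
      simp [p]
    change c (p τ x) * (σ _ : G) = x
    rw [h1, h, hcp]
    simp
  refine ⟨⟨p σ, p σ.symm, hpp _ _ (by simp), hpp _ _ (by simp)⟩, fun x => ?_, fun x k => ?_⟩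
  · have h : x⁻¹ * p σ x = ((c x)⁻¹ * x)⁻¹ * σ ⟨(c x)⁻¹ * x, hc x⟩ := by
      simp [p, mul_assoc]
    change x⁻¹ * p σ x ∈ F
    rw [h]
    exact mul_mem (inv_mem (hc x)) (SetLike.coe_mem _)
  · change p σ (x * f k) = p σ x * f' k
    have h := congrArg Subtype.val (hσ ⟨(c x)⁻¹ * x, hc x⟩ k)
    simp only [p, hcm _ _ (hfF k), mul_assoc]
    congr 1
    refine Eq.trans ?_ h
    congr 2
    ext
    simp [mul_assoc]

/-- Permutations of `G × T` which preserve the second coordinate and, in the first one, the left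
cosets of `F`. -/
def cosetPreserving {G : Type*} (T : Type*) [Group G] (F : Subgroup G) :
    Subgroup (Equiv.Perm (G × T)) where
  carrier := {u | ∀ p, (u p).2 = p.2 ∧ p.1⁻¹ * (u p).1 ∈ F}
  one_mem' p := by simp
  mul_mem' {u v} hu hv p := by
    refine ⟨(hu (v p)).1.trans (hv p).1, ?_⟩
    have h := mul_mem (hv p).2 (hu (v p)).2
    rwa [mul_assoc, mul_inv_cancel_left] at h
  inv_mem' {u} hu p := by
    have h := hu (u⁻¹ p)
    rw [← Equiv.Perm.mul_apply, mul_inv_cancel, Equiv.Perm.one_apply] at h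
    refine ⟨h.1.symm, ?_⟩
    have h2 := inv_mem h.2
    rwa [mul_inv_rev, inv_inv] at h2

theorem cosetPreserving_mono {G : Type*} (T : Type*) [Group G] :
    Monotone (cosetPreserving (G := G) T) :=
  fun _ _ h _ hu p => ⟨(hu p).1, h (hu p).2⟩

theorem locallyFinite_cosetPreserving {G : Type*} (T : Type*) [Group G] (F : Subgroup G)
    (hF : (F : Set G).Finite) : LocallyFiniteGroup (cosetPreserving T F) := by
  have : Finite F := hF.to_subtype
  have hmem : ∀ (u : cosetPreserving T F) (p : G × T) (y : F),
      p.1⁻¹ * (u.1 (p.1 * y, p.2)).1 ∈ F := by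
    intro u p y
    have h := mul_mem y.2 (u.2 (p.1 * y, p.2)).2
    rwa [mul_inv_rev, mul_assoc, mul_inv_cancel_left] at h
  have hmul : ∀ (u v : cosetPreserving T F) (p : G × T) (y : F),
      (⟨_, hmem (u * v) p y⟩ : F) = ⟨_, hmem u p ⟨_, hmem v p y⟩⟩ := by
    intro u v p y
    ext
    have h : ((p.1 * (p.1⁻¹ * (v.1 (p.1 * y, p.2)).1) : G), p.2) = v.1 (p.1 * y, p.2) := by
      ext
      · simp
      · exact (v.2 (p.1 * y, p.2)).1.symm
    simp only [h]
    rfl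
  have hone : ∀ (p : G × T) (y : F), (⟨_, hmem 1 p y⟩ : F) = y := by
    intro p y
    ext
    simp
  let r : cosetPreserving T F →* (G × T → Equiv.Perm F) :=
    { toFun := fun u p =>
        { toFun := fun y => ⟨_, hmem u p y⟩
          invFun := fun y => ⟨_, hmem u⁻¹ p y⟩
          left_inv := fun y => by
            refine (hmul u⁻¹ u p y).symm.trans ?_
            simp only [inv_mul_cancel]
            exact hone p y
          right_inv := fun y => by
            refine (hmul u u⁻¹ p y).symm.trans ?_
            simp only [mul_inv_cancel]
            exact hone p y }
      map_one' := by
        ext p y : 2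
        exact hone p y
      map_mul' := fun u v => by
        ext p y : 2
        exact hmul u v p y }
  refine (LocallyFiniteGroup.pi (G × T) (Equiv.Perm F)).of_injective r fun u v huv => ?_
  ext p : 2
  have h := congrArg Subtype.val (Equiv.congr_fun (congrFun huv p) 1)
  have h1 : p.1⁻¹ * (u.1 (p.1 * 1, p.2)).1 = p.1⁻¹ * (v.1 (p.1 * 1, p.2)).1 := h
  rw [mul_one] at h1
  exact Prod.ext (mul_left_cancel h1) ((u.2 p).1.trans (v.2 p).1.symm)

section CanonicalExtension

open scoped Pointwise Classical

variable {G : Type} [Group G]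

/-- `π` preserves the left cosets of every subgroup containing the entries of `s`. -/
def PreservesCosets (s : Finset (G × G)) (π : Equiv.Perm G) : Prop :=
  ∀ F : Subgroup G, (∀ p ∈ s, p.1 ∈ F ∧ p.2 ∈ F) → ∀ x, x⁻¹ * π x ∈ F

/-- `π` intertwines the right multiplications by `a` and `b` for all `(a, b) ∈ s`. -/
def Intertwines (s : Finset (G × G)) (π : Equiv.Perm G) : Prop :=
  ∀ p ∈ s, ∀ x, π (x * p.1) = π x * p.2

/-- The conjugate of a permutation of `G` by an automorphism of `G`. -/
def permConj (α : MulAut G) (π : Equiv.Perm G) : Equiv.Perm G :=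
  MulAction.toPerm α * π * (MulAction.toPerm α)⁻¹

theorem permConj_apply (α : MulAut G) (π : Equiv.Perm G) (x : G) :
    permConj α π x = α (π (α⁻¹ x)) := rfl

theorem PreservesCosets.conj {s : Finset (G × G)} {π : Equiv.Perm G} (α : MulAut G)
    (h : PreservesCosets s π) : PreservesCosets (α • s) (permConj α π) := by
  intro F hF x
  have h1 := h (F.comap α.toMonoidHom)
    (fun p hp => hF (α • p) (Finset.smul_mem_smul_finset hp)) (α⁻¹ x)
  simpa [permConj_apply] using h1

theorem Intertwines.conj {s : Finset (G × G)} {π : Equiv.Perm G} (α : MulAut G)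
    (h : Intertwines s π) : Intertwines (α • s) (permConj α π) := by
  intro p' hp' x
  obtain ⟨p, hp, rfl⟩ := Finset.mem_smul_finset.1 hp'
  have h1 := congrArg α (h p hp (α⁻¹ x))
  simpa [permConj_apply] using h1

/-- `π` preserves the cosets of `s`, and it intertwines `s` if any such permutation does. -/
def IsChoice (s : Finset (G × G)) (π : Equiv.Perm G) : Prop :=
  PreservesCosets s π ∧ ((∃ π', PreservesCosets s π' ∧ Intertwines s π') → Intertwines s π)

theorem IsChoice.conj {s : Finset (G × G)} {π : Equiv.Perm G} (α : MulAut G)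
    (h : IsChoice s π) : IsChoice (α • s) (permConj α π) := by
  refine ⟨h.1.conj α, ?_⟩
  rintro ⟨π', h1, h2⟩
  refine (h.2 ⟨permConj α⁻¹ π', ?_, ?_⟩).conj α
  · simpa using h1.conj α⁻¹
  · simpa using h2.conj α⁻¹

theorem exists_isChoice (s : Finset (G × G)) : ∃ π, IsChoice s π := by
  by_cases h : ∃ π', PreservesCosets s π' ∧ Intertwines s π'
  · obtain ⟨π, hπ⟩ := h
    exact ⟨π, hπ.1, fun _ => hπ.2⟩
  · exact ⟨1, fun F _ x => by simp, fun h' => absurd h' h⟩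

variable (G) in
/-- The simultaneous choices of a permutation for every finite set of pairs. -/
def PermChoice : Type := {τ : Finset (G × G) → Equiv.Perm G // ∀ s, IsChoice s (τ s)}

instance : Nonempty (PermChoice G) :=
  ⟨⟨fun s => (exists_isChoice s).choose, fun s => (exists_isChoice s).choose_spec⟩⟩

noncomputable instance : MulAction (MulAut G) (PermChoice G) where
  smul α τ := ⟨fun s => permConj α (τ.1 (α⁻¹ • s)), fun s => by
    simpa using (τ.2 (α⁻¹ • s)).conj α⟩
  one_smul τ := by
    refine Subtype.ext (funext fun s => ?_)
    change permConj 1 (τ.1 ((1 : MulAut G)⁻¹ • s)) = τ.1 s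
    ext x
    simp [permConj_apply]
  mul_smul α β τ := by
    refine Subtype.ext (funext fun s => ?_)
    change permConj (α * β) (τ.1 ((α * β)⁻¹ • s)) =
      permConj α (permConj β (τ.1 (β⁻¹ • α⁻¹ • s)))
    ext x
    simp [permConj_apply, mul_smul]

theorem PermChoice.smul_apply (α : MulAut G) (τ : PermChoice G) (s : Finset (G × G)) (x : G) :
    (α • τ).1 s x = α (τ.1 (α⁻¹ • s) (α⁻¹ x)) := rfl

variable (G) in
/-- The regular representation of `G` on the first factor of `G × PermChoice G`. -/
def regularPerm : G →* Equiv.Perm (G × PermChoice G) where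
  toFun g := (Equiv.mulRight g⁻¹).prodCongr (Equiv.refl _)
  map_one' := by ext p : 1; simp
  map_mul' g h := by ext p : 1; exact Prod.ext (by simp [mul_assoc]) rfl

theorem regularPerm_apply (g : G) (p : G × PermChoice G) :
    regularPerm G g p = (p.1 * g⁻¹, p.2) := rfl

/-- The permutation of `G × PermChoice G` which acts on each fibre over `PermChoice G` by the
permutation chosen for `s`. -/
def choicePerm (s : Finset (G × G)) : Equiv.Perm (G × PermChoice G) where
  toFun p := (p.2.1 s p.1, p.2)
  invFun p := ((p.2.1 s).symm p.1, p.2)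
  left_inv p := by simp
  right_inv p := by simp

theorem choicePerm_apply (s : Finset (G × G)) (p : G × PermChoice G) :
    choicePerm s p = (p.2.1 s p.1, p.2) := rfl

variable (G) in
/-- The action of the automorphisms of `G` on the permutations of `G × PermChoice G`. -/
noncomputable def autPerm : MulAut G →* MulAut (Equiv.Perm (G × PermChoice G)) :=
  MulAut.conj.comp (MulAction.toPermHom (MulAut G) (G × PermChoice G))

theorem autPerm_apply (α : MulAut G) (u : Equiv.Perm (G × PermChoice G)) (p : G × PermChoice G) :
    autPerm G α u p = α • u (α⁻¹ • p) := rfl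

theorem autPerm_regularPerm (α : MulAut G) (g : G) :
    autPerm G α (regularPerm G g) = regularPerm G (α g) := by
  ext p : 1
  refine Prod.ext ?_ ?_
  · simp [autPerm_apply, regularPerm_apply]
  · simp [autPerm_apply, regularPerm_apply]

theorem autPerm_choicePerm (α : MulAut G) (s : Finset (G × G)) :
    autPerm G α (choicePerm s) = choicePerm (α • s) := by
  ext p : 1
  refine Prod.ext ?_ ?_
  · simp [autPerm_apply, choicePerm_apply, PermChoice.smul_apply]
  · simp [autPerm_apply, choicePerm_apply]

variable (G) in
/-- The generators of the canonical extension of `G`. -/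
def extensionGenerators : Set (Equiv.Perm (G × PermChoice G)) :=
  Set.range (regularPerm G) ∪ Set.range choicePerm

theorem autPerm_mem_extensionGenerators (α : MulAut G) (u : Equiv.Perm (G × PermChoice G))
    (hu : u ∈ extensionGenerators G) : autPerm G α u ∈ extensionGenerators G := by
  rcases hu with ⟨g, rfl⟩ | ⟨s, rfl⟩
  · exact Or.inl ⟨_, (autPerm_regularPerm α g).symm⟩
  · exact Or.inr ⟨_, (autPerm_choicePerm α s).symm⟩

theorem locallyFinite_closure_extensionGenerators (hG : LocallyFiniteGroup G) :
    LocallyFiniteGroup (Subgroup.closure (extensionGenerators G)) := by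
  refine hG.closure_of_monotone _ (cosetPreserving_mono (PermChoice G))
    (locallyFinite_cosetPreserving _) _ ?_
  rintro _ (⟨g, rfl⟩ | ⟨s, rfl⟩)
  · refine ⟨Subgroup.closure {g}, hG _ (Set.finite_singleton g), fun p => ⟨rfl, ?_⟩⟩
    rw [regularPerm_apply, inv_mul_cancel_left]
    exact inv_mem (Subgroup.subset_closure rfl)
  · refine ⟨Subgroup.closure (Prod.fst '' (s : Set (G × G)) ∪ Prod.snd '' (s : Set (G × G))),
      hG _ ((s.finite_toSet.image _).union (s.finite_toSet.image _)), fun p => ⟨rfl, ?_⟩⟩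
    exact (p.2.2 s).1 _ (fun q hq => ⟨Subgroup.subset_closure (Or.inl ⟨q, hq, rfl⟩),
      Subgroup.subset_closure (Or.inr ⟨q, hq, rfl⟩)⟩) _

theorem exists_choicePerm_conj (hG : LocallyFiniteGroup G) {K : Type*} [Group K] [Finite K]
    (f f' : K →* G) (hf : Function.Injective f) (hf' : Function.Injective f') :
    ∃ s : Finset (G × G), ∀ k,
      regularPerm G (f' k) = choicePerm s * regularPerm G (f k) * (choicePerm s)⁻¹ := by
  have := Fintype.ofFinite K
  let s : Finset (G × G) := Finset.univ.image fun k => (f k, f' k)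
  have hs : ∀ k, (f k, f' k) ∈ s := fun k => Finset.mem_image_of_mem _ (Finset.mem_univ k)
  let F : Subgroup G := Subgroup.closure (Set.range f ∪ Set.range f')
  have hgood : ∃ π, PreservesCosets s π ∧ Intertwines s π := by
    obtain ⟨π, h1, h2⟩ := exists_perm_mul_right f f' hf hf' F
      (hG _ ((Set.finite_range f).union (Set.finite_range f')))
      (fun k => Subgroup.subset_closure (Or.inl ⟨k, rfl⟩))
      (fun k => Subgroup.subset_closure (Or.inr ⟨k, rfl⟩))
    refine ⟨π, fun F' hF' x => ?_, fun p hp x => ?_⟩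
    · refine (Subgroup.closure_le F').2 ?_ (h1 x)
      rintro _ (⟨k, rfl⟩ | ⟨k, rfl⟩)
      · exact (hF' _ (hs k)).1
      · exact (hF' _ (hs k)).2
    · obtain ⟨k, -, rfl⟩ := Finset.mem_image.1 hp
      exact h2 x k
  refine ⟨s, fun k => ?_⟩
  rw [eq_mul_inv_iff_mul_eq]
  ext p : 1
  refine Prod.ext ?_ rfl
  have h := (p.2.2 s).2 hgood _ (hs k⁻¹) p.1
  simp only [map_inv] at h
  exact h.symm

/-- Every countable locally finite group has a countable locally finite extension to which all
automorphisms extend coherently and in which its finite embeddings become conjugate. -/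
theorem exists_canonical_extension [Countable G] (hG : LocallyFiniteGroup G) :
    ∃ (E : Type) (_ : Group E) (j : G →* E) (ext : MulAut G →* MulAut E),
      Countable E ∧ LocallyFiniteGroup E ∧ Function.Injective j ∧
      (∀ α x, ext α (j x) = j (α x)) ∧ ConjugatesFiniteEmbeddings j := by
  let E := Subgroup.closure (extensionGenerators G)
  have hE : ∀ g, regularPerm G g ∈ E := fun g => Subgroup.subset_closure (Or.inl ⟨g, rfl⟩)
  refine ⟨E, inferInstance, (regularPerm G).codRestrict E hE,
    MulAut.restrictHom (autPerm G) E
      (MulAut.map_mem_closure_of_forall _ _ autPerm_mem_extensionGenerators),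
    Subgroup.countable_closure_of_countable
      ((Set.countable_range _).union (Set.countable_range _)),
    locallyFinite_closure_extensionGenerators hG, fun g h hgh => ?_,
    fun α x => Subtype.ext (autPerm_regularPerm α x), fun K _ _ f f' hf hf' => ?_⟩
  · obtain ⟨τ⟩ : Nonempty (PermChoice G) := inferInstance
    have h1 := congrArg (fun e : E => (e.1 (1, τ)).1) hgh
    simpa [regularPerm_apply] using h1
  · obtain ⟨s, hs⟩ := exists_choicePerm_conj hG f f' hf hf'
    exact ⟨⟨choicePerm s, Subgroup.subset_closure (Or.inr ⟨s, rfl⟩)⟩,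
      fun k => Subtype.ext (hs k)⟩

end CanonicalExtension

/-- A tower of groups with compatible actions of `A` has a union with an action of `A`. -/
theorem exists_union_of_tower {A : Type*} [Group A] (G : ℕ → Type) [∀ n, Group (G n)]
    (j : ∀ n, G n →* G (n + 1)) (hj : ∀ n, Function.Injective (j n))
    (act : ∀ n, A →* MulAut (G n)) (hact : ∀ n a x, act (n + 1) a (j n x) = j n (act n a x)) :
    ∃ (L : Type) (_ : Group L) (ι : ∀ n, G n →* L) (actL : A →* MulAut L),
      (∀ n, Function.Injective (ι n)) ∧ (∀ n x, ι (n + 1) (j n x) = ι n x) ∧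
      (∀ y, ∃ n x, ι n x = y) ∧ ∀ a n x, actL a (ι n x) = ι n (act n a x) := by
  let f : ∀ m n, m ≤ n → G m →* G n := fun m n h =>
    Nat.leRec (motive := fun n _ => G m →* G n) (MonoidHom.id _) (fun k _ g => (j k).comp g) h
  have hself : ∀ m, f m m le_rfl = MonoidHom.id _ := fun m => Nat.leRec_self ..
  have hsucc : ∀ m n (h : m ≤ n), f m (n + 1) (h.trans n.le_succ) = (j n).comp (f m n h) :=
    fun m n h => Nat.leRec_succ ..
  have hcomp : ∀ m n k (h : m ≤ n) (h' : n ≤ k) x, f n k h' (f m n h x) = f m k (h.trans h') x := by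
    intro m n k h h' x
    induction k, h' using Nat.le_induction with
    | base => simp [hself]
    | succ k h' ih =>
      rw [hsucc n k h', hsucc m k (h.trans h')]
      simp [ih]
  have hinj : ∀ m n h, Function.Injective (f m n h) := by
    intro m n h
    induction n, h using Nat.le_induction with
    | base => simpa [hself] using Function.injective_id
    | succ n h ih =>
      rw [hsucc m n h]
      exact (hj n).comp ih
  have hactf : ∀ a m n h x, f m n h (act m a x) = act n a (f m n h x) := by
    intro a m n h x
    induction n, h using Nat.le_induction with
    | base => simp [hself]
    | succ n h ih =>
      rw [hsucc m n h]
      simp [ih, hact]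
  have : DirectedSystem G (f · · ·) :=
    { map_self := fun i x => by simp [hself]
      map_map := fun k j i hij hjk x => hcomp _ _ _ hij hjk x }
  let L := DirectLimit G f
  let φ : A → L → L := fun a => DirectLimit.map f f (fun n => act n a) (hactf a)
  have hφ : ∀ a n (x : G n),
      φ a (⟦⟨n, x⟩⟧ : DirectLimit G f) = (⟦⟨n, act n a x⟩⟧ : DirectLimit G f) :=
    fun _ _ _ => rfl
  have hφmul : ∀ a b y, φ (a * b) y = φ a (φ b y) := fun a b =>
    DirectLimit.induction f fun n x => by simp [hφ]
  have hφone : ∀ y, φ 1 y = y := DirectLimit.induction f fun n x => by simp [hφ]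
  refine ⟨L, inferInstance,
    fun n =>
      { toFun := fun x => (⟦⟨n, x⟩⟧ : DirectLimit G f)
        map_one' := (DirectLimit.one_def n).symm
        map_mul' := fun x y => (DirectLimit.mul_def n x y).symm },
    { toFun := fun a =>
        { toFun := φ a
          invFun := φ a⁻¹
          left_inv := fun y => by rw [← hφmul, inv_mul_cancel, hφone]
          right_inv := fun y => by rw [← hφmul, mul_inv_cancel, hφone]
          map_mul' := DirectLimit.induction₂ f fun n x y => by
            rw [DirectLimit.mul_def, hφ, hφ, hφ, DirectLimit.mul_def, map_mul] }
      map_one' := MulEquiv.ext hφone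
      map_mul' := fun a b => MulEquiv.ext (hφmul a b) },
    fun n => DirectLimit.mk_injective f hinj n, fun n x => ?_, fun y => ?_, fun a n x => rfl⟩
  · have h : j n x = f n (n + 1) n.le_succ x := by rw [hsucc n n le_rfl, hself]; rfl
    change (⟦⟨n + 1, j n x⟩⟧ : DirectLimit G f) = ⟦⟨n, x⟩⟧
    rw [h]
    exact DirectLimit.mk_apply n (n + 1) x n.le_succ
  · obtain ⟨n, x, h⟩ := DirectLimit.exists_eq_mk f y
    exact ⟨n, x, h.symm⟩

/-- The characteristic properties of Hall's universal group. -/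
structure IsHallUniversal (G : Type) [Group G] : Prop where
  countable : Countable G
  locallyFinite : LocallyFiniteGroup G
  exists_embedding : ∀ (K : Type) [Group K] [Finite K], ∃ e : K →* G, Function.Injective e
  conjugates : ConjugatesFiniteEmbeddings (MonoidHom.id G)

/-- A countable locally finite group with an action of `A` which contains all finite groups has an
equivariant embedding into Hall's universal group. -/
theorem exists_hallUniversal_extension {A : Type*} [Group A] {G₀ : Type} [Group G₀] [Countable G₀]
    (hG₀ : LocallyFiniteGroup G₀) (act₀ : A →* MulAut G₀)
    (hemb : ∀ (K : Type) [Group K] [Finite K], ∃ e : K →* G₀, Function.Injective e) :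
    ∃ (L : Type) (_ : Group L) (i : G₀ →* L) (actL : A →* MulAut L), IsHallUniversal L ∧
      Function.Injective i ∧ ∀ a x, actL a (i x) = i (act₀ a x) := by
  let Stage := Σ' (G : Type) (_ : Group G) (_ : A →* MulAut G), Countable G ∧ LocallyFiniteGroup G
  let _ (S : Stage) : Group S.1 := S.2.1
  have hnext : ∀ S : Stage, ∃ (S' : Stage) (j : S.1 →* S'.1), Function.Injective j ∧
      (∀ a x, S'.2.2.1 a (j x) = j (S.2.2.1 a x)) ∧ ConjugatesFiniteEmbeddings j := by
    intro S
    have := S.2.2.2.1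
    obtain ⟨E, _, j, ext, hE, hE', hj, hext, hconj⟩ := exists_canonical_extension S.2.2.2.2
    exact ⟨⟨E, _, ext.comp S.2.2.1, hE, hE'⟩, j, hj, fun a x => hext _ x, hconj⟩
  choose next j hj hact hconj using hnext
  let S : ℕ → Stage := fun n => Nat.rec ⟨G₀, _, act₀, inferInstance, hG₀⟩ (fun _ => next) n
  obtain ⟨L, _, ι, actL, hι, hιj, hsurj, hactL⟩ := exists_union_of_tower (fun n => (S n).1)
    (fun n => j (S n)) (fun n => hj _) (fun n => (S n).2.2.1) (fun n => hact _)
  have hmono : Monotone fun n => (ι n).range := monotone_nat_of_le_succ fun n => by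
    rintro _ ⟨x, rfl⟩
    exact ⟨_, hιj n x⟩
  have hfin : ∀ s : Set L, s.Finite → ∃ n, s ⊆ (ι n).range := by
    intro s hs
    choose d x hx using hsurj
    obtain ⟨n, hn⟩ := (hs.image d).bddAbove
    exact ⟨n, fun y hy => hmono (hn (Set.mem_image_of_mem d hy)) ⟨_, hx y⟩⟩
  refine ⟨L, _, ι 0, actL, ⟨?_, fun s hs => ?_, fun K _ _ => ?_, ?_⟩, hι 0,
    fun a x => hactL a 0 x⟩
  · have (n : ℕ) : Countable (S n).1 := (S n).2.2.2.1
    have h : Function.Surjective fun p : Σ n, (S n).1 => ι p.1 p.2 := fun y => by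
      obtain ⟨n, x, h⟩ := hsurj y
      exact ⟨⟨n, x⟩, h⟩
    exact h.countable
  · obtain ⟨n, hn⟩ := hfin s hs
    have h := (S n).2.2.2.2 (ι n ⁻¹' s) (hs.preimage (hι n).injOn)
    have h2 := h.image (ι n)
    rwa [← Subgroup.coe_map, MonoidHom.map_closure, Set.image_preimage_eq_of_subset hn] at h2
  · obtain ⟨e, he⟩ := hemb K
    exact ⟨(ι 0).comp e, (hι 0).comp he⟩
  · intro K _ _ f f' hf hf'
    obtain ⟨n, hn⟩ := hfin _ ((Set.finite_range f).union (Set.finite_range f'))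
    have hlift : ∀ g : K →* L, Function.Injective g → Set.range g ⊆ (ι n).range →
        ∃ g' : K →* (S n).1, Function.Injective g' ∧ ∀ k, ι n (g' k) = g k := by
      intro g hg hgn
      have hgn' : ∀ k, g k ∈ (ι n).range := fun k => hgn ⟨k, rfl⟩
      let g' : K →* (S n).1 :=
        (MonoidHom.ofInjective (hι n)).symm.toMonoidHom.comp (g.codRestrict _ hgn')
      have hg' : ∀ k, ι n (g' k) = g k := fun k =>
        MonoidHom.apply_ofInjective_symm (hι n) ⟨g k, hgn' k⟩
      exact ⟨g', fun k k' h => hg (by rw [← hg', ← hg', h]), hg'⟩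
    obtain ⟨g, hg, hgf⟩ := hlift f hf (Set.subset_union_left.trans hn)
    obtain ⟨g', hg', hgf'⟩ := hlift f' hf' (Set.subset_union_right.trans hn)
    obtain ⟨t, ht⟩ := hconj (S n) K g g' hg hg'
    refine ⟨ι (n + 1) t, fun k => ?_⟩
    have h : ι (n + 1) (j (S n) (g' k)) =
        ι (n + 1) t * ι (n + 1) (j (S n) (g k)) * (ι (n + 1) t)⁻¹ := by
      rw [ht, map_mul, map_mul, map_inv]
    rwa [hιj, hιj, hgf, hgf'] at h

/-- The finite subgroups of `X × Y` which are graphs of isomorphisms between subgroups. -/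
def FinitePartialIso (X Y : Type*) [Group X] [Group Y] : Type _ :=
  {P : Subgroup (X × Y) // (P : Set (X × Y)).Finite ∧
    (∀ p ∈ P, p.1 = 1 → p.2 = 1) ∧ ∀ p ∈ P, p.2 = 1 → p.1 = 1}

namespace FinitePartialIso

variable {X Y : Type} [Group X] [Group Y]

instance : Preorder (FinitePartialIso X Y) := inferInstanceAs (Preorder (Subtype _))

/-- The inverse of a partial isomorphism. -/
def symm (P : FinitePartialIso X Y) : FinitePartialIso Y X :=
  ⟨P.1.map (MulEquiv.prodComm : X × Y ≃* Y × X).toMonoidHom, P.2.1.image _, by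
    rintro _ ⟨p, hp, rfl⟩
    exact P.2.2.2 p hp, by
    rintro _ ⟨p, hp, rfl⟩
    exact P.2.2.1 p hp⟩

theorem mem_symm {P : FinitePartialIso X Y} {x : X} {y : Y} :
    (y, x) ∈ P.symm.1 ↔ (x, y) ∈ P.1 := by
  constructor
  · rintro ⟨p, hp, h⟩
    obtain ⟨rfl, rfl⟩ := Prod.ext_iff.1 h
    exact hp
  · exact fun h => ⟨_, h, rfl⟩

theorem exists_le_of_left (hX : LocallyFiniteGroup X) (hY : IsHallUniversal Y)
    (P : FinitePartialIso X Y) (x : X) : ∃ Q, P ≤ Q ∧ ∃ y, (x, y) ∈ Q.1 := by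
  have hP : Finite P.1 := P.2.1.to_subtype
  let C : Subgroup X := Subgroup.closure (Prod.fst '' (P.1 : Set (X × Y)) ∪ {x})
  have hC : Finite C := (hX _ ((P.2.1.image _).union (Set.finite_singleton x))).to_subtype
  have hPC : ∀ p : P.1, p.1.1 ∈ C := fun p => Subgroup.subset_closure (Or.inl ⟨p, p.2, rfl⟩)
  have hxC : x ∈ C := Subgroup.subset_closure (Or.inr rfl)
  obtain ⟨e, he⟩ := hY.exists_embedding C
  let a : P.1 →* C := ((MonoidHom.fst X Y).comp P.1.subtype).codRestrict C hPC
  have ha : Function.Injective a := by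
    rw [injective_iff_map_eq_one]
    intro p hp
    have h : p.1.1 = 1 := congrArg Subtype.val hp
    exact Subtype.ext (Prod.ext h (P.2.2.1 _ p.2 h))
  have hb : Function.Injective ((MonoidHom.snd X Y).comp P.1.subtype) := by
    rw [injective_iff_map_eq_one]
    intro p hp
    have h : p.1.2 = 1 := hp
    exact Subtype.ext (Prod.ext (P.2.2.2 _ p.2 h) h)
  obtain ⟨t, ht⟩ := hY.conjugates P.1 (e.comp a) _ (he.comp ha) hb
  let e' : C →* Y := (MulAut.conj t).toMonoidHom.comp e
  have he' : Function.Injective e' := (MulAut.conj t).injective.comp he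
  let g : C →* X × Y := C.subtype.prod e'
  refine ⟨⟨g.range, Set.finite_range g, ?_, ?_⟩, ?_, e' ⟨x, hxC⟩, ⟨x, hxC⟩, rfl⟩
  · rintro _ ⟨c, rfl⟩ hc
    have h : c = 1 := Subtype.ext hc
    simp [h]
  · rintro _ ⟨c, rfl⟩ hc
    have h : c = 1 := he' (hc.trans (map_one e').symm)
    simp [h]
  · exact fun p hp => ⟨⟨p.1, hPC ⟨p, hp⟩⟩, Prod.ext rfl (ht ⟨p, hp⟩).symm⟩

theorem exists_le_of_right (hX : IsHallUniversal X) (hY : LocallyFiniteGroup Y)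
    (P : FinitePartialIso X Y) (y : Y) : ∃ Q, P ≤ Q ∧ ∃ x, (x, y) ∈ Q.1 := by
  obtain ⟨Q, hQ, x, hx⟩ := exists_le_of_left hY hX P.symm y
  exact ⟨Q.symm, fun p hp => mem_symm.2 (hQ (mem_symm.2 hp)), x, mem_symm.2 hx⟩

end FinitePartialIso

/-- Hall's universal group is unique up to isomorphism. -/
theorem IsHallUniversal.nonempty_mulEquiv {X Y : Type} [Group X] [Group Y]
    (hX : IsHallUniversal X) (hY : IsHallUniversal Y) : Nonempty (X ≃* Y) := by
  have := hX.countable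
  have := hY.countable
  have := Encodable.ofCountable (X ⊕ Y)
  let D : X ⊕ Y → Order.Cofinal (FinitePartialIso X Y) := Sum.elim
    (fun x => ⟨{Q | ∃ y, (x, y) ∈ Q.1}, fun P => by
      obtain ⟨Q, hQ, h⟩ := P.exists_le_of_left hX.locallyFinite hY x
      exact ⟨Q, h, hQ⟩⟩)
    (fun y => ⟨{Q | ∃ x, (x, y) ∈ Q.1}, fun P => by
      obtain ⟨Q, hQ, h⟩ := P.exists_le_of_right hX hY.locallyFinite y
      exact ⟨Q, h, hQ⟩⟩)
  let bot : FinitePartialIso X Y := ⟨⊥, by simp, by simp, by simp⟩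
  let Q := Order.sequenceOfCofinals bot D
  have hQ : Monotone Q := Order.sequenceOfCofinals.monotone bot D
  let U : Subgroup (X × Y) := ⨆ n, (Q n).1
  have hU : ∀ p, p ∈ U ↔ ∃ n, p ∈ (Q n).1 := fun p =>
    Subgroup.mem_iSup_of_directed (Monotone.directed_le fun _ _ h => hQ h)
  let a : U →* X := (MonoidHom.fst X Y).comp U.subtype
  let b : U →* Y := (MonoidHom.snd X Y).comp U.subtype
  have ha : Function.Bijective a := by
    refine ⟨(injective_iff_map_eq_one a).2 fun p hp => ?_, fun x => ?_⟩
    · obtain ⟨n, hn⟩ := (hU _).1 p.2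
      exact Subtype.ext (Prod.ext hp ((Q n).2.2.1 _ hn hp))
    · obtain ⟨y, hy⟩ := Order.sequenceOfCofinals.encode_mem bot D (Sum.inl x)
      exact ⟨⟨(x, y), (hU _).2 ⟨_, hy⟩⟩, rfl⟩
  have hb : Function.Bijective b := by
    refine ⟨(injective_iff_map_eq_one b).2 fun p hp => ?_, fun y => ?_⟩
    · obtain ⟨n, hn⟩ := (hU _).1 p.2
      exact Subtype.ext (Prod.ext ((Q n).2.2.2 _ hn hp) hp)
    · obtain ⟨x, hx⟩ := Order.sequenceOfCofinals.encode_mem bot D (Sum.inr y)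
      exact ⟨⟨(x, y), (hU _).2 ⟨_, hx⟩⟩, rfl⟩
  exact ⟨(MulEquiv.ofBijective a ha).symm.trans (MulEquiv.ofBijective b hb)⟩

/-- The permutations of `I` act on a countable locally finite group containing copies of `H` indexed
by `I`, namely the restricted direct power of `H`, by permuting these copies. -/
theorem exists_restricted_power {I H : Type} [Countable I] [Group H] [Countable H]
    (hH : LocallyFiniteGroup H) :
    ∃ (E : Type) (_ : Group E) (act : Equiv.Perm I →* MulAut E) (e : I → H →* E),
      Countable E ∧ LocallyFiniteGroup E ∧ (∀ σ i x, act σ (e i x) = e (σ i) x) ∧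
      (∀ i, Function.Injective (e i)) ∧ ∀ i i' x, e i x = e i' x → x ≠ 1 → i = i' := by
  classical
  let S : Set (I → H) := Set.range fun p : I × H => Pi.mulSingle p.1 p.2
  have hact : ∀ (σ : Equiv.Perm I) i (x : H),
      mulAutArrow σ (Pi.mulSingle i x : I → H) = Pi.mulSingle (σ i) x := by
    intro σ i x
    ext k
    change (Pi.mulSingle i x : I → H) (σ⁻¹ k) = _
    simp only [Pi.mulSingle_apply, Equiv.Perm.inv_eq_iff_eq]
  have hmem : ∀ i x, (Pi.mulSingle i x : I → H) ∈ Subgroup.closure S :=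
    fun i x => Subgroup.subset_closure ⟨(i, x), rfl⟩
  refine ⟨Subgroup.closure S, inferInstance,
    MulAut.restrictHom (mulAutArrow : Equiv.Perm I →* MulAut (I → H)) _
      (MulAut.map_mem_closure_of_forall _ _ ?_),
    fun i => (MonoidHom.mulSingle (fun _ => H) i).codRestrict _ (hmem i),
    Subgroup.countable_closure_of_countable (Set.countable_range _), ?_,
    fun σ i x => Subtype.ext (hact σ i x),
    fun i x y h => Pi.mulSingle_injective i (congrArg Subtype.val h), fun i i' x h hx => ?_⟩
  · rintro σ _ ⟨p, rfl⟩
    exact ⟨(σ p.1, p.2), (hact σ p.1 p.2).symm⟩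
  · refine hH.closure_of_monotone (fun F => Subgroup.pi Set.univ fun _ => F)
      (fun _ _ h u hu i hi => h (hu i hi)) (fun F hF => ?_) S ?_
    · have : Finite F := hF.to_subtype
      let r : Subgroup.pi Set.univ (fun _ : I => F) →* (I → F) :=
        { toFun := fun u i => ⟨u.1 i, u.2 i trivial⟩
          map_one' := rfl
          map_mul' := fun _ _ => rfl }
      exact (LocallyFiniteGroup.pi I F).of_injective r fun u v h =>
        Subtype.ext (funext fun i => congrArg Subtype.val (congrFun h i))
    · rintro _ ⟨⟨i, x⟩, rfl⟩
      refine ⟨Subgroup.closure {x}, hH _ (Set.finite_singleton x), fun k _ => ?_⟩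
      simp only [Pi.mulSingle_apply]
      split_ifs
      · exact Subgroup.subset_closure rfl
      · exact one_mem (Subgroup.closure {x})
  · by_contra hne
    have h1 : (Pi.mulSingle i x : I → H) i = (Pi.mulSingle i' x : I → H) i :=
      congrFun (congrArg Subtype.val h) i
    rw [Pi.mulSingle_eq_same, Pi.mulSingle_eq_of_ne hne] at h1
    exact hx h1

/-- **`Aut(H)` embeds the full symmetric group on a countably infinite set.**
If `H` is Hall's universal group, then there is an injective group homomorphism from
`Sym(ℕ)` into `Aut(H)`. -/
theorem sym_nat_embeds_in_aut_hall
    {H : Type} [Group H] [Countable H]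
    (hLF : ∀ s : Finset H, ((Subgroup.closure (s : Set H) : Subgroup H) : Set H).Finite)
    (hEmb : ∀ (G : Type) [Group G] [Finite G], ∃ e : G →* H, Function.Injective e)
    (hHom : ∀ K L : Subgroup H, (K : Set H).Finite → (L : Set H).Finite →
      ∀ φ : ↥K ≃* ↥L, ∃ h : H, ∀ k : K, (φ k : H) = h * (k : H) * h⁻¹) :
    ∃ Φ : Equiv.Perm ℕ →* MulAut H, Function.Injective Φ := by
  have hH : IsHallUniversal H :=
    { countable := inferInstance
      locallyFinite := fun s hs => by simpa using hLF hs.toFinset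
      exists_embedding := fun K _ _ => hEmb K
      conjugates := fun K _ _ f f' hf hf' => by
        obtain ⟨t, ht⟩ := hHom f.range f'.range (Set.finite_range f) (Set.finite_range f')
          ((MonoidHom.ofInjective hf).symm.trans (MonoidHom.ofInjective hf'))
        refine ⟨t, fun k => ?_⟩
        have h := ht (MonoidHom.ofInjective hf k)
        rwa [MulEquiv.trans_apply, MulEquiv.symm_apply_apply] at h }
  obtain ⟨E, _, act, e, _, hE, hact, he, hne⟩ := exists_restricted_power (I := ℕ) hH.locallyFinite
  obtain ⟨L, _, i, actL, hL, hi, hactL⟩ := exists_hallUniversal_extension hE act fun K _ _ => by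
    obtain ⟨g, hg⟩ := hEmb K
    exact ⟨(e 0).comp g, (he 0).comp hg⟩
  obtain ⟨c⟩ := hL.nonempty_mulEquiv hH
  obtain ⟨x, hx⟩ : ∃ x : H, x ≠ 1 := by
    obtain ⟨g, hg⟩ := hEmb (Equiv.Perm Bool)
    have := hg.nontrivial
    exact exists_ne 1
  refine ⟨(MulAut.congr c).toMonoidHom.comp actL,
    (MulAut.congr c).injective.comp fun σ τ h => Equiv.ext fun n => ?_⟩
  have h1 := DFunLike.congr_fun h (i (e n x))
  rw [hactL, hactL, hact, hact] at h1
  exact hne _ _ x (hi h1) hx
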